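/- Let (X,d,m) be an isotropic PI space. Fix a set E ⊆ X of finite perimeter and an open set Ω ⊆ X. Suppose (E_n)_{n∈ℕ} is a partition of E into sets of finite perimeter such that P(E,Ω) = Σ_{n=0}^∞ P(E_n,Ω). Then P(F,Ω) = Σ_{n=0}^∞ P(F ∩ E_n, Ω) for every Borel set F ⊆ E with P(F) < +∞. -/

import Mathlib

open MeasureTheory Metric Filter Set
open scoped ENNReal NNReal Topology

namespace PaperBV

noncomputable section

variable {X : Type*} [MetricSpace X]

/-- `f` is locally Lipschitz on `Ω`. -/
def LocLipOn (Ω : Set X) (f : X → ℝ) : Prop :=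
  ∀ x ∈ Ω, ∃ K : ℝ≥0, ∃ t ∈ 𝓝[Ω] x, LipschitzOnWith K f t

/-- The local Lipschitz constant (slope) `lip f` of a function, with value `0` at
points that are not accumulation points (there the filter `𝓝[≠] x` is trivial). -/
def lipConst (f : X → ℝ) (x : X) : ℝ≥0∞ :=
  Filter.limsup (fun y => ENNReal.ofReal (|f y - f x| / dist y x)) (𝓝[≠] x)

variable [MeasurableSpace X]

/-- Convergence `fn → f` in `L¹_loc(μ⌊Ω)`. -/
def TendstoL1loc (μ : Measure X) (Ω : Set X) (fn : ℕ → X → ℝ) (f : X → ℝ) : Prop :=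
  ∀ K : Set X, IsCompact K → K ⊆ Ω →
    Filter.Tendsto (fun n => ∫⁻ x in K, ENNReal.ofReal |fn n x - f x| ∂μ)
      Filter.atTop (𝓝 0)

/-- The total variation `|Df|(Ω)` of `f` on an open set `Ω`, defined by relaxation of the
integral of the local Lipschitz constant along locally Lipschitz approximations. -/
def tvOpen (μ : Measure X) (f : X → ℝ) (Ω : Set X) : ℝ≥0∞ :=
  sInf { a : ℝ≥0∞ | ∃ fn : ℕ → X → ℝ, (∀ n, LocLipOn Ω (fn n)) ∧ TendstoL1loc μ Ω fn f ∧
    a = Filter.liminf (fun n => ∫⁻ x in Ω, lipConst (fn n) x ∂μ) Filter.atTop }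

/-- The total variation measure `|Df|(B)` of `f` on an arbitrary set, obtained from the
values on open sets by the Carathéodory construction. -/
def tv (μ : Measure X) (f : X → ℝ) (B : Set X) : ℝ≥0∞ :=
  ⨅ (Ω : Set X) (_ : IsOpen Ω) (_ : B ⊆ Ω), tvOpen μ f Ω

/-- `f` is a function of bounded variation: `f ∈ L¹(μ)` and `|Df|(X) < ∞`. -/
def BVFun (μ : Measure X) (f : X → ℝ) : Prop :=
  MeasureTheory.Integrable f μ ∧ tv μ f Set.univ < ⊤

/-- The perimeter `P(E, B) = |D 1_E|(B)`. -/
def perim (μ : Measure X) (E B : Set X) : ℝ≥0∞ :=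
  tv μ (E.indicator fun _ => (1 : ℝ)) B

/-- `E` is a (Borel) set of finite perimeter. -/
def FinPerim (μ : Measure X) (E : Set X) : Prop :=
  MeasurableSet E ∧ perim μ E Set.univ < ⊤

/-- `μ` is a doubling measure with doubling constant `CD`. -/
def Doubling (μ : Measure X) (CD : ℝ≥0) : Prop :=
  1 ≤ CD ∧ ∀ (x : X) (r : ℝ), 0 < r → μ (ball x (2 * r)) ≤ (CD : ℝ≥0∞) * μ (ball x r)

/-- The mean value `f_{x,r}` of `f` on the ball `B_r(x)`. -/
def ballAvg (μ : Measure X) (f : X → ℝ) (x : X) (r : ℝ) : ℝ :=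
  (∫ y in ball x r, f y ∂μ) / (μ (ball x r)).toReal

/-- The weak `(1,1)`-Poincaré inequality with constants `CP`, `lam`,
for locally Lipschitz functions. -/
def WeakPoincare (μ : Measure X) (CP lam : ℝ) : Prop :=
  ∀ f : X → ℝ, LocLipOn Set.univ f → ∀ (x : X) (r : ℝ), 0 < r →
    ∫⁻ y in ball x r, ENNReal.ofReal |f y - ballAvg μ f x r| ∂μ ≤
      ENNReal.ofReal (CP * r) * ∫⁻ y in ball x (lam * r), lipConst f y ∂μ

/-- A PI space: doubling and supporting a weak `(1,1)`-Poincaré inequality. -/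
def IsPI (μ : Measure X) : Prop :=
  ∃ (CD : ℝ≥0) (CP lam : ℝ), Doubling μ CD ∧ 0 < CP ∧ 1 ≤ lam ∧ WeakPoincare μ CP lam

/-- The pre-measure `H_δ` of the codimension-one Hausdorff measure: infimum over countable
covers by balls of radii at most `δ` of `∑ μ(B_{r_i}(x_i)) / (2 r_i)`. -/
def preH (μ : Measure X) (δ : ℝ) (S : Set X) : ℝ≥0∞ :=
  ⨅ (c : ℕ → X × ℝ) (_ : ∀ i, 0 < (c i).2 ∧ (c i).2 ≤ δ)
    (_ : S ⊆ ⋃ i, ball (c i).1 (c i).2),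
    ∑' i, μ (ball (c i).1 (c i).2) / ENNReal.ofReal (2 * (c i).2)

/-- The codimension-one Hausdorff measure `H = lim_{δ ↓ 0} H_δ = sup_{δ > 0} H_δ`
(as an outer-measure-type set function). -/
def codimH (μ : Measure X) (S : Set X) : ℝ≥0∞ :=
  ⨆ (δ : ℝ) (_ : 0 < δ), preH μ δ S

/-- The upper density of `E` at `x`. -/
def upperDens (μ : Measure X) (E : Set X) (x : X) : ℝ≥0∞ :=
  Filter.limsup (fun r : ℝ => μ (E ∩ ball x r) / μ (ball x r)) (𝓝[>] (0 : ℝ))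

/-- The essential boundary `∂^e E`. -/
def essBdry (μ : Measure X) (E : Set X) : Set X :=
  {x | 0 < upperDens μ E x ∧ 0 < upperDens μ Eᶜ x}

/-- The essential interior `E^1`: points of density `1`. -/
def essInt (μ : Measure X) (E : Set X) : Set X :=
  {x | Filter.Tendsto (fun r : ℝ => μ (E ∩ ball x r) / μ (ball x r))
    (𝓝[>] (0 : ℝ)) (𝓝 (1 : ℝ≥0∞))}

/-- Integral `∫_S f dν` with respect to an outer-measure-type set function `ν`,
via the layer-cake formula. -/
def outerLint (ν : Set X → ℝ≥0∞) (S : Set X) (f : X → ℝ≥0∞) : ℝ≥0∞ :=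
  ∫⁻ t in Set.Ioi (0 : ℝ), ν {x ∈ S | ENNReal.ofReal t < f x}

/-- `θ` is a family of densities representing the perimeter measures with respect to the
codimension-one Hausdorff measure: `P(E,B) = ∫_{B ∩ ∂^e E} θ_E dH`, with
`γ ≤ θ_E ≤ C` on `∂^e E` for structural constants `0 < γ`, `C < ∞`. -/
def PerimRepr (μ : Measure X) (θ : Set X → X → ℝ≥0∞) : Prop :=
  ∃ γ C : ℝ≥0∞, 0 < γ ∧ C ≠ ⊤ ∧
    ∀ E : Set X, FinPerim μ E →
      (∀ x ∈ essBdry μ E, γ ≤ θ E x ∧ θ E x ≤ C) ∧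
      ∀ B : Set X, MeasurableSet B →
        perim μ E B = outerLint (codimH μ) (B ∩ essBdry μ E) (θ E)

/-- The space is isotropic: the densities `θ_E` can be chosen so that, whenever `F ⊆ E` are
sets of finite perimeter, `θ_F = θ_E` holds `H`-a.e. on `∂^e F ∩ ∂^e E`. -/
def Isotropic (μ : Measure X) : Prop :=
  ∃ θ : Set X → X → ℝ≥0∞, PerimRepr μ θ ∧
    ∀ E F : Set X, FinPerim μ E → FinPerim μ F → F ⊆ E →
      codimH μ {x ∈ essBdry μ F ∩ essBdry μ E | θ F x ≠ θ E x} = 0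

/-- Property (1.2): `H(∂^e E ∩ ∂^e F ∩ ∂^e (E ∪ F)) = 0` for disjoint sets of finite
perimeter. -/
def Prop12 (μ : Measure X) : Prop :=
  ∀ E F : Set X, FinPerim μ E → FinPerim μ F → Disjoint E F →
    codimH μ (essBdry μ E ∩ essBdry μ F ∩ essBdry μ (E ∪ F)) = 0

/-- `E` is decomposable in `B`: `E ∩ B` admits a partition into two sets of finite perimeter
and positive measure such that the perimeter in `B` is additive. -/
def DecomposableIn (μ : Measure X) (E B : Set X) : Prop :=
  ∃ F G : Set X, FinPerim μ F ∧ FinPerim μ G ∧ Disjoint F G ∧ F ∪ G = E ∩ B ∧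
    0 < μ F ∧ 0 < μ G ∧ perim μ E B = perim μ F B + perim μ G B

/-- `E` is a set of finite perimeter which is indecomposable in `B`. -/
def IndecomposableIn (μ : Measure X) (E B : Set X) : Prop :=
  FinPerim μ E ∧ ¬ DecomposableIn μ E B

/-- `E` is an indecomposable set (of finite perimeter). -/
def Indecomposable (μ : Measure X) (E : Set X) : Prop :=
  IndecomposableIn μ E Set.univ

/-- `E` is a simple set. -/
def SimpleSet (μ : Measure X) (E : Set X) : Prop :=
  FinPerim μ E ∧ μ E < ⊤ ∧
  ∀ F : Set X, FinPerim μ F → codimH μ (essBdry μ F \ essBdry μ E) = 0 →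
    μ F = 0 ∨ μ Fᶜ = 0 ∨ μ (symmDiff F E) = 0 ∨ μ (symmDiff F Eᶜ) = 0

end
section CodimensionOneMeasure

variable {X : Type*} [MetricSpace X] [MeasurableSpace X] {μ : Measure X}

lemma preH_mono (δ : ℝ) {S T : Set X} (h : S ⊆ T) : preH μ δ S ≤ preH μ δ T :=
  iInf_mono fun _ => iInf_mono fun _ => iInf_mono' fun hT => ⟨h.trans hT, le_rfl⟩

lemma preH_le_tsum {δ : ℝ} {S : Set X} {c : ℕ → X × ℝ}
    (hc : ∀ i, 0 < (c i).2 ∧ (c i).2 ≤ δ) (hS : S ⊆ ⋃ i, ball (c i).1 (c i).2) :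
    preH μ δ S ≤ ∑' i, μ (ball (c i).1 (c i).2) / ENNReal.ofReal (2 * (c i).2) :=
  iInf_le_of_le c <| iInf_le_of_le hc <| iInf_le _ hS

lemma exists_cover_of_preH_lt {δ : ℝ} {S : Set X} {a : ℝ≥0∞} (h : preH μ δ S < a) :
    ∃ c : ℕ → X × ℝ, (∀ i, 0 < (c i).2 ∧ (c i).2 ≤ δ) ∧ (S ⊆ ⋃ i, ball (c i).1 (c i).2) ∧
      ∑' i, μ (ball (c i).1 (c i).2) / ENNReal.ofReal (2 * (c i).2) < a := by
  simp only [preH, iInf_lt_iff] at h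
  obtain ⟨c, h1, h2, h3⟩ := h
  exact ⟨c, h1, h2, h3⟩

lemma preH_le_codimH {δ : ℝ} (hδ : 0 < δ) (S : Set X) : preH μ δ S ≤ codimH μ S :=
  le_iSup₂ (f := fun (δ : ℝ) (_ : 0 < δ) => preH μ δ S) δ hδ

lemma preH_anti {δ δ' : ℝ} (h : δ ≤ δ') (S : Set X) : preH μ δ' S ≤ preH μ δ S :=
  iInf_mono fun _ => iInf_mono' fun hc => ⟨fun i => ⟨(hc i).1, (hc i).2.trans h⟩, le_rfl⟩

lemma codimH_mono {S T : Set X} (h : S ⊆ T) : codimH μ S ≤ codimH μ T :=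
  iSup₂_mono fun δ _ => preH_mono δ h

lemma preH_iUnion_le (δ : ℝ) (S : ℕ → Set X) :
    preH μ δ (⋃ n, S n) ≤ ∑' n, preH μ δ (S n) := by
  refine ENNReal.le_of_forall_pos_le_add fun ε hε hfin => ?_
  obtain ⟨ε', hε', hsum⟩ := ENNReal.exists_pos_sum_of_countable
    (ENNReal.coe_pos.2 hε).ne' ℕ
  have hlt : ∀ n, preH μ δ (S n) < preH μ δ (S n) + ε' n := fun n =>
    ENNReal.lt_add_right (ENNReal.ne_top_of_tsum_ne_top hfin.ne n) (by simpa using (hε' n).ne')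
  choose c hc hcov hsumc using fun n => exists_cover_of_preH_lt (hlt n)
  let d : ℕ → X × ℝ := fun k => c (Nat.unpair k).1 (Nat.unpair k).2
  calc preH μ δ (⋃ n, S n)
      ≤ ∑' k, μ (ball (d k).1 (d k).2) / ENNReal.ofReal (2 * (d k).2) := by
        refine preH_le_tsum (fun k => hc _ _) (iUnion_subset fun n x hx => ?_)
        obtain ⟨i, hi⟩ := mem_iUnion.1 (hcov n hx)
        exact mem_iUnion.2 ⟨Nat.pair n i, by simpa [d] using hi⟩
    _ = ∑' p : ℕ × ℕ, μ (ball (c p.1 p.2).1 (c p.1 p.2).2) /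
          ENNReal.ofReal (2 * (c p.1 p.2).2) :=
        Nat.pairEquiv.symm.tsum_eq
          (fun p : ℕ × ℕ => μ (ball (c p.1 p.2).1 (c p.1 p.2).2) /
            ENNReal.ofReal (2 * (c p.1 p.2).2))
    _ = ∑' n, ∑' i, μ (ball (c n i).1 (c n i).2) / ENNReal.ofReal (2 * (c n i).2) :=
        ENNReal.tsum_prod
          (f := fun n i => μ (ball (c n i).1 (c n i).2) / ENNReal.ofReal (2 * (c n i).2))
    _ ≤ ∑' n, (preH μ δ (S n) + ε' n) := ENNReal.tsum_le_tsum fun n => (hsumc n).le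
    _ = ∑' n, preH μ δ (S n) + ∑' n, (ε' n : ℝ≥0∞) := ENNReal.tsum_add
    _ ≤ ∑' n, preH μ δ (S n) + ε := by gcongr

/-- The codimension-one Hausdorff measure as an outer measure. The covers in `preH` are
infinite sequences of balls, so that `codimH μ ∅ = 0` is not automatic. -/
noncomputable def codimOuter (h0 : codimH μ ∅ = 0) : OuterMeasure X where
  measureOf := codimH μ
  empty := h0
  mono := codimH_mono
  iUnion_nat S _ := iSup₂_le fun δ hδ => (preH_iUnion_le δ S).trans <|
    ENNReal.tsum_le_tsum fun n => preH_le_codimH hδ (S n)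

lemma codimOuter_apply (h0 : codimH μ ∅ = 0) (S : Set X) : codimOuter h0 S = codimH μ S := rfl

lemma preH_add_le_of_separated (h0 : codimH μ ∅ = 0) {S T : Set X} {δ : ℝ} (hδ : 0 < δ)
    (hST : ∀ x ∈ S, ∀ y ∈ T, 2 * δ ≤ dist x y) :
    preH μ δ S + preH μ δ T ≤ preH μ δ (S ∪ T) := by
  classical
  refine ENNReal.le_of_forall_pos_le_add fun ε hε hfin => ?_
  have hε3 : (0 : ℝ≥0∞) < ε / 3 := ENNReal.div_pos (by simpa using hε.ne') (by simp)
  have hempty : preH μ δ (∅ : Set X) < ε / 3 :=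
    (preH_le_codimH hδ _).trans_lt (by rwa [h0])
  obtain ⟨d, hd, -, hdsum⟩ := exists_cover_of_preH_lt hempty
  obtain ⟨c, hc, hcov, hcsum⟩ :=
    exists_cover_of_preH_lt (ENNReal.lt_add_right hfin.ne hε3.ne')
  let w : X × ℝ → ℝ≥0∞ := fun p => μ (ball p.1 p.2) / ENNReal.ofReal (2 * p.2)
  let I : Set ℕ := {i | (S ∩ ball (c i).1 (c i).2).Nonempty}
  let a : ℕ → X × ℝ := fun i => if i ∈ I then c i else d i
  let b : ℕ → X × ℝ := fun i => if i ∈ I then d i else c i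
  have ha : preH μ δ S ≤ ∑' i, w (a i) := by
    refine preH_le_tsum (fun i => ?_) fun x hx => ?_
    · by_cases hi : i ∈ I
      · simpa [a, hi] using hc i
      · simpa [a, hi] using hd i
    · obtain ⟨i, hi⟩ := mem_iUnion.1 (hcov (Or.inl hx))
      have hiI : i ∈ I := ⟨x, hx, hi⟩
      exact mem_iUnion.2 ⟨i, by simpa [a, hiI] using hi⟩
  have hb : preH μ δ T ≤ ∑' i, w (b i) := by
    refine preH_le_tsum (fun i => ?_) fun y hy => ?_
    · by_cases hi : i ∈ I
      · simpa [b, hi] using hd i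
      · simpa [b, hi] using hc i
    · obtain ⟨i, hi⟩ := mem_iUnion.1 (hcov (Or.inr hy))
      have hiI : i ∉ I := by
        rintro ⟨x, hx, hxi⟩
        have h1 := hST x hx y hy
        have h2 := dist_triangle_right x y (c i).1
        rw [mem_ball] at hi hxi
        have := (hc i).2
        linarith
      exact mem_iUnion.2 ⟨i, by simpa [b, hiI] using hi⟩
  have hsum : ∀ i, w (a i) + w (b i) = w (c i) + w (d i) := fun i => by
    by_cases hi : i ∈ I <;> simp [a, b, hi, add_comm]
  calc preH μ δ S + preH μ δ T ≤ ∑' i, w (a i) + ∑' i, w (b i) := add_le_add ha hb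
    _ = ∑' i, w (c i) + ∑' i, w (d i) := by
        rw [← ENNReal.tsum_add, ← ENNReal.tsum_add]; simp_rw [hsum]
    _ ≤ (preH μ δ (S ∪ T) + ε / 3) + ε / 3 := add_le_add hcsum.le hdsum.le
    _ ≤ (preH μ δ (S ∪ T) + ε / 3) + ε / 3 + ε / 3 := le_self_add
    _ = preH μ δ (S ∪ T) + ε := by
        rw [add_assoc, add_assoc, ← add_assoc (_ / _), ENNReal.add_thirds]

lemma codimOuter_isMetric (h0 : codimH μ ∅ = 0) : (codimOuter h0).IsMetric := by
  rintro S T ⟨r, hr, hST⟩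
  refine le_antisymm (measure_union_le _ _) ?_
  simp only [codimOuter_apply]
  obtain ⟨ρ, hρ0, hρ⟩ : ∃ ρ : ℝ, 0 < ρ ∧ ∀ x ∈ S, ∀ y ∈ T, 2 * ρ ≤ dist x y := by
    obtain ⟨q, hq0, hq⟩ := ENNReal.lt_iff_exists_nnreal_btwn.1 (pos_iff_ne_zero.2 hr)
    refine ⟨q / 2, by simpa using hq0, fun x hx y hy => ?_⟩
    have h1 := hq.le.trans (hST x hx y hy)
    rw [edist_nndist, ENNReal.coe_le_coe] at h1
    have h2 : (q : ℝ) ≤ dist x y := by exact_mod_cast h1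
    linarith
  refine ENNReal.biSup_add_biSup_le' ⟨1, one_pos⟩ ⟨1, one_pos⟩ fun δ₁ h₁ δ₂ h₂ => ?_
  have hδ : 0 < min ρ (min δ₁ δ₂) := lt_min hρ0 (lt_min h₁ h₂)
  calc preH μ δ₁ S + preH μ δ₂ T
      ≤ preH μ (min ρ (min δ₁ δ₂)) S + preH μ (min ρ (min δ₁ δ₂)) T :=
        add_le_add (preH_anti ((min_le_right _ _).trans (min_le_left _ _)) S)
          (preH_anti ((min_le_right _ _).trans (min_le_right _ _)) T)
    _ ≤ preH μ (min ρ (min δ₁ δ₂)) (S ∪ T) :=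
        preH_add_le_of_separated h0 hδ fun x hx y hy =>
          (by linarith [min_le_left ρ (min δ₁ δ₂)] : _ ≤ 2 * ρ).trans (hρ x hx y hy)
    _ ≤ codimH μ (S ∪ T) := preH_le_codimH hδ _

/-- Integrals of nonnegative functions against the codimension-one Hausdorff measure are
countably additive on Borel sets, without any measurability of the integrand. -/
lemma exists_measure_outerLint [BorelSpace X] (h0 : codimH μ ∅ = 0) (S : Set X)
    (f : X → ℝ≥0∞) :
    ∃ ν : Measure X, ∀ B, MeasurableSet B → ν B = outerLint (codimH μ) (B ∩ S) f := by
  have hcar : ∀ B, MeasurableSet B → (codimOuter h0).IsCaratheodory B := by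
    intro B hB
    refine (codimOuter_isMetric h0).borel_le_caratheodory B ?_
    rwa [← BorelSpace.measurable_eq]
  have key : ∀ T : Set X, ∀ B : ℕ → Set X, (∀ i, MeasurableSet (B i)) →
      Pairwise (Function.onFun Disjoint B) →
      codimH μ ((⋃ i, B i) ∩ T) = ∑' i, codimH μ (B i ∩ T) := by
    intro T B hB hd
    have h := OuterMeasure.f_iUnion (OuterMeasure.restrict T (codimOuter h0)) (s := B)
      (fun i t => by
        simp only [OuterMeasure.restrict_apply]
        have := hcar _ (hB i) (t ∩ T)
        rw [this, inter_right_comm, show (t ∩ T) \ B i = t \ B i ∩ T by grind]) hd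
    simpa only [OuterMeasure.restrict_apply, codimOuter_apply] using h
  have hset : ∀ (B : Set X) (t : ℝ), {x ∈ B ∩ S | ENNReal.ofReal t < f x} =
      B ∩ {x ∈ S | ENNReal.ofReal t < f x} := fun B t => by
    ext x; exact and_assoc
  refine ⟨Measure.ofMeasurable (fun B _ => outerLint (codimH μ) (B ∩ S) f) ?_ ?_, ?_⟩
  · simp [outerLint, h0]
  · intro B hB hd
    simp only [outerLint, hset]
    rw [← lintegral_tsum]
    · exact lintegral_congr fun t => key _ B hB hd
    · intro i
      refine Antitone.measurable (fun s t hst => codimH_mono ?_) |>.aemeasurable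
      exact inter_subset_inter_right _ fun x hx =>
        ⟨hx.1, (ENNReal.ofReal_le_ofReal hst).trans_lt hx.2⟩
  · intro B hB
    rw [Measure.ofMeasurable_apply _ hB]

end CodimensionOneMeasure

section TotalVariation

variable {X : Type*} [MetricSpace X]

lemma LocLipOn.continuousOn {Ω : Set X} {f : X → ℝ} (hf : LocLipOn Ω f) : ContinuousOn f Ω := by
  intro x hx
  obtain ⟨K, t, ht, hK⟩ := hf x hx
  exact (hK.continuousOn x (mem_of_mem_nhdsWithin hx ht)).mono_of_mem_nhdsWithin ht

lemma LocLipOn.mono {Ω Ω' : Set X} {f : X → ℝ} (hf : LocLipOn Ω' f) (h : Ω ⊆ Ω') :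
    LocLipOn Ω f := fun x hx =>
  let ⟨K, t, ht, hK⟩ := hf x (h hx)
  ⟨K, t, nhdsWithin_mono x h ht, hK⟩

lemma LocLipOn.map₂ {φ : ℝ → ℝ → ℝ} (hφ : ∀ a b c d, |φ a b - φ c d| ≤ max |a - c| |b - d|)
    {Ω : Set X} {f g : X → ℝ} (hf : LocLipOn Ω f) (hg : LocLipOn Ω g) :
    LocLipOn Ω fun x => φ (f x) (g x) := by
  intro x hx
  obtain ⟨K, s, hs, hK⟩ := hf x hx
  obtain ⟨L, t, ht, hL⟩ := hg x hx
  refine ⟨max K L, s ∩ t, inter_mem hs ht, LipschitzOnWith.of_dist_le_mul fun y hy z hz => ?_⟩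
  have h1 := hK.dist_le_mul y hy.1 z hz.1
  have h2 := hL.dist_le_mul y hy.2 z hz.2
  rw [Real.dist_eq] at h1 h2 ⊢
  refine (hφ _ _ _ _).trans (max_le (h1.trans ?_) (h2.trans ?_))
  · gcongr; exact le_max_left _ _
  · gcongr; exact le_max_right _ _

lemma lipConst_map₂_le {φ : ℝ → ℝ → ℝ}
    (hφ : ∀ a b c d, |φ a b - φ c d| ≤ max |a - c| |b - d|) (f g : X → ℝ) (x : X) :
    lipConst (fun y => φ (f y) (g y)) x ≤ lipConst f x + lipConst g x := by
  calc lipConst (fun y => φ (f y) (g y)) x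
      ≤ limsup (fun y => max (ENNReal.ofReal (|f y - f x| / dist y x))
          (ENNReal.ofReal (|g y - g x| / dist y x))) (𝓝[≠] x) := by
        refine limsup_le_limsup (Eventually.of_forall fun y => ?_)
        beta_reduce
        rw [← ENNReal.ofReal_max, max_div_div_right dist_nonneg]
        gcongr
        exact hφ _ _ _ _
    _ = max (lipConst f x) (lipConst g x) := limsup_max
    _ ≤ lipConst f x + lipConst g x := max_le le_self_add le_add_self

lemma lipConst_eq_iInf {Ω : Set X} (hΩ : IsOpen Ω) (f : X → ℝ) {x : X} (hx : x ∈ Ω) :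
    lipConst f x = ⨅ n : ℕ, ⨆ y ∈ ball x (1 / (n + 1)) ∩ (Ω \ {x}),
      ENNReal.ofReal (|f y - f x| / dist y x) := by
  have hnhds : 𝓝[≠] x = 𝓝[Ω \ {x}] x := by
    rw [sdiff_eq, nhdsWithin_inter_of_mem]
    exact mem_nhdsWithin_of_mem_nhds (hΩ.mem_nhds hx)
  rw [lipConst, hnhds,
    (nhdsWithin_hasBasis nhds_basis_ball_inv_nat_succ (Ω \ {x})).limsup_eq_iInf_iSup]
  simp

lemma aemeasurable_lipConst [MeasurableSpace X] [OpensMeasurableSpace X] {μ : Measure X}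
    {Ω : Set X} (hΩ : IsOpen Ω) {f : X → ℝ} (hf : ContinuousOn f Ω) :
    AEMeasurable (lipConst f) (μ.restrict Ω) := by
  let G : ℕ → X → ℝ≥0∞ := fun n x => ⨆ y ∈ ball x (1 / (n + 1)) ∩ (Ω \ {x}),
      ENNReal.ofReal (|f y - f x| / dist y x)
  have hG : ∀ n, Measurable (Ω.indicator (G n)) := by
    refine fun n => measurable_of_Ioi fun c => IsOpen.measurableSet ?_
    rw [isOpen_iff_mem_nhds]
    intro x hx
    have hxΩ : x ∈ Ω := by
      by_contra h
      simp [indicator_of_notMem h] at hx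
    rw [mem_preimage, indicator_of_mem hxΩ, mem_Ioi] at hx
    simp only [G, lt_iSup_iff] at hx
    obtain ⟨y, ⟨hyx, hyΩ, hne⟩, hc⟩ := hx
    have hne' : dist y x ≠ 0 := dist_ne_zero.2 hne
    have hcont : ContinuousAt (fun z => ENNReal.ofReal (|f y - f z| / dist y z)) x :=
      ENNReal.continuous_ofReal.continuousAt.comp
        ((continuousAt_const.sub (hf.continuousAt (hΩ.mem_nhds hxΩ))).abs.div
          (continuousAt_const.dist continuousAt_id) hne')
    have hball : ∀ᶠ z in 𝓝 x, dist y z < 1 / ((n : ℝ) + 1) :=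
      (continuousAt_const.dist continuousAt_id).eventually_lt_const hyx
    have hneq : ∀ᶠ z in 𝓝 x, dist y z ≠ 0 :=
      (continuousAt_const.dist continuousAt_id).eventually_ne hne'
    filter_upwards [hΩ.mem_nhds hxΩ, hball, hneq, hcont.eventually_const_lt hc]
      with z hz h1 h2 h3
    rw [mem_preimage, indicator_of_mem hz, mem_Ioi]
    simp only [G, lt_iSup_iff]
    exact ⟨y, ⟨h1, hyΩ, dist_ne_zero.1 h2⟩, h3⟩
  refine ⟨fun x => ⨅ n, Ω.indicator (G n) x, Measurable.iInf hG, ?_⟩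
  filter_upwards [ae_restrict_mem hΩ.measurableSet] with x hx
  simp only [indicator_of_mem hx, lipConst_eq_iInf hΩ f hx, G]

variable [MeasurableSpace X] {μ : Measure X}

lemma tvOpen_le_liminf {f : X → ℝ} {Ω : Set X} {fn : ℕ → X → ℝ} (hlip : ∀ n, LocLipOn Ω (fn n))
    (hconv : TendstoL1loc μ Ω fn f) :
    tvOpen μ f Ω ≤ liminf (fun n => ∫⁻ x in Ω, lipConst (fn n) x ∂μ) atTop :=
  sInf_le ⟨fn, hlip, hconv, rfl⟩

lemma tvOpen_mono (f : X → ℝ) {Ω Ω' : Set X} (h : Ω ⊆ Ω') : tvOpen μ f Ω ≤ tvOpen μ f Ω' := by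
  refine le_sInf ?_
  rintro _ ⟨fn, hlip, hconv, rfl⟩
  exact (tvOpen_le_liminf (fun n => (hlip n).mono h)
    fun K hK hKΩ => hconv K hK (hKΩ.trans h)).trans
    (liminf_le_liminf (Eventually.of_forall fun n => lintegral_mono_set h))

lemma tv_eq_tvOpen (f : X → ℝ) {Ω : Set X} (hΩ : IsOpen Ω) : tv μ f Ω = tvOpen μ f Ω :=
  le_antisymm (iInf_le_of_le Ω <| iInf_le_of_le hΩ <| iInf_le _ Subset.rfl)
    (le_iInf fun _ => le_iInf fun _ => le_iInf fun h => tvOpen_mono f h)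

lemma tv_mono (f : X → ℝ) {B B' : Set X} (h : B ⊆ B') : tv μ f B ≤ tv μ f B' :=
  iInf_mono fun _ => iInf_mono fun _ => iInf_mono' fun hB => ⟨h.trans hB, le_rfl⟩

lemma exists_locLipOn_of_tvOpen_lt {f : X → ℝ} {Ω K : Set X} {a ε : ℝ≥0∞}
    (h : tvOpen μ f Ω < a) (hK : IsCompact K) (hKΩ : K ⊆ Ω) (hε : 0 < ε) :
    ∃ g, LocLipOn Ω g ∧ ∫⁻ x in K, ENNReal.ofReal |g x - f x| ∂μ < ε ∧
      ∫⁻ x in Ω, lipConst g x ∂μ < a := by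
  obtain ⟨_, ⟨fn, hlip, hconv, rfl⟩, hlt⟩ := sInf_lt_iff.1 h
  obtain ⟨n, h1, h2⟩ := ((frequently_lt_of_liminf_lt (by isBoundedDefault) hlt).and_eventually
    ((hconv K hK hKΩ).eventually_lt_const hε)).exists
  exact ⟨fn n, hlip n, h2, h1⟩

lemma tvOpen_le_of_forall_approx [ProperSpace X] {f : X → ℝ} {Ω : Set X} (hΩ : IsOpen Ω)
    {a : ℝ≥0∞} (h : ∀ K, IsCompact K → K ⊆ Ω → ∀ ε : ℝ≥0∞, 0 < ε →
      ∃ g, LocLipOn Ω g ∧ ∫⁻ x in K, ENNReal.ofReal |g x - f x| ∂μ ≤ ε ∧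
        ∫⁻ x in Ω, lipConst g x ∂μ ≤ a) :
    tvOpen μ f Ω ≤ a := by
  have : LocallyCompactSpace Ω := hΩ.locallyCompactSpace
  let L := CompactExhaustion.choice Ω
  have hL : ∀ n, IsCompact ((↑) '' L n : Set X) := fun n =>
    (L.isCompact n).image continuous_subtype_val
  have hpos : ∀ n : ℕ, (0 : ℝ≥0∞) < (n + 1 : ℝ≥0∞)⁻¹ := fun n =>
    ENNReal.inv_pos.2 (by finiteness)
  choose g hg1 hg2 hg3 using fun n : ℕ => h _ (hL n) (by simp) _ (hpos n)
  have hlim : Tendsto (fun n : ℕ => (n + 1 : ℝ≥0∞)⁻¹) atTop (𝓝 0) := by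
    have := (tendsto_add_atTop_iff_nat 1).2 ENNReal.tendsto_inv_nat_nhds_zero
    simpa using this
  refine (tvOpen_le_liminf hg1 fun K hK hKΩ => ?_).trans
    ((liminf_le_liminf (Eventually.of_forall hg3)).trans (liminf_const a).le)
  have hK' : IsCompact ((↑) ⁻¹' K : Set Ω) := by
    rw [Subtype.isCompact_iff, Subtype.image_preimage_coe, inter_eq_self_of_subset_right hKΩ]
    exact hK
  obtain ⟨N, hN⟩ := L.exists_superset_of_isCompact hK'
  refine tendsto_of_tendsto_of_tendsto_of_le_of_le' tendsto_const_nhds hlim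
    (Eventually.of_forall fun _ => zero_le) ?_
  filter_upwards [eventually_ge_atTop N] with n hn
  refine (lintegral_mono_set fun x hx => ?_).trans (hg2 n)
  exact ⟨⟨x, hKΩ hx⟩, L.subset hn (hN hx), rfl⟩

lemma tvOpen_le_of_tendstoL1loc [ProperSpace X] {u : ℕ → X → ℝ} {v : X → ℝ}
    (hu : ∀ n, Measurable (u n)) (hv : Measurable v) {Ω : Set X} (hΩ : IsOpen Ω)
    (hconv : TendstoL1loc μ Ω u v) {a : ℝ≥0∞} (ha : ∀ n, tvOpen μ (u n) Ω ≤ a) :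
    tvOpen μ v Ω ≤ a := by
  refine ENNReal.le_of_forall_pos_le_add fun ε hε hfin => ?_
  refine tvOpen_le_of_forall_approx hΩ fun K hK hKΩ η hη => ?_
  have hη2 : 0 < η / 2 := ENNReal.half_pos hη.ne'
  obtain ⟨n, hn⟩ := ((hconv K hK hKΩ).eventually_lt_const hη2).exists
  obtain ⟨f, hf, hfK, hfΩ⟩ := exists_locLipOn_of_tvOpen_lt
    ((ha n).trans_lt (ENNReal.lt_add_right hfin.ne (ENNReal.coe_ne_zero.2 hε.ne'))) hK hKΩ hη2
  refine ⟨f, hf, ?_, hfΩ.le⟩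
  calc ∫⁻ x in K, ENNReal.ofReal |f x - v x| ∂μ
      ≤ ∫⁻ x in K, (ENNReal.ofReal |f x - u n x| + ENNReal.ofReal |u n x - v x|) ∂μ := by
        refine lintegral_mono fun x => ?_
        rw [← ENNReal.ofReal_add (abs_nonneg _) (abs_nonneg _)]
        exact ENNReal.ofReal_le_ofReal (abs_sub_le _ _ _)
    _ = ∫⁻ x in K, ENNReal.ofReal |f x - u n x| ∂μ + ∫⁻ x in K, ENNReal.ofReal |u n x - v x| ∂μ :=
        lintegral_add_right _ ((hu n).sub hv).norm.ennreal_ofReal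
    _ ≤ η / 2 + η / 2 := add_le_add hfK.le hn.le
    _ = η := ENNReal.add_halves η

variable [BorelSpace X] [ProperSpace X]

lemma tvOpen_map₂_le {φ : ℝ → ℝ → ℝ}
    (hφ : ∀ a b c d, |φ a b - φ c d| ≤ max |a - c| |b - d|) {u v : X → ℝ} (hu : Measurable u)
    {Ω : Set X} (hΩ : IsOpen Ω) :
    tvOpen μ (fun x => φ (u x) (v x)) Ω ≤ tvOpen μ u Ω + tvOpen μ v Ω := by
  refine ENNReal.le_of_forall_pos_le_add fun ε hε hfin => ?_
  have hε2 : (ε / 2 : ℝ≥0∞) ≠ 0 := (ENNReal.half_pos (by simpa using hε.ne')).ne'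
  obtain ⟨hfu, hfv⟩ := ENNReal.add_lt_top.1 hfin
  have hu' := ENNReal.lt_add_right hfu.ne hε2
  have hv' := ENNReal.lt_add_right hfv.ne hε2
  refine tvOpen_le_of_forall_approx hΩ fun K hK hKΩ η hη => ?_
  have hη2 : 0 < η / 2 := ENNReal.half_pos hη.ne'
  obtain ⟨f, hf, hfK, hfΩ⟩ := exists_locLipOn_of_tvOpen_lt hu' hK hKΩ hη2
  obtain ⟨g, hg, hgK, hgΩ⟩ := exists_locLipOn_of_tvOpen_lt hv' hK hKΩ hη2
  refine ⟨_, hf.map₂ hφ hg, ?_, ?_⟩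
  · calc ∫⁻ x in K, ENNReal.ofReal |φ (f x) (g x) - φ (u x) (v x)| ∂μ
        ≤ ∫⁻ x in K, (ENNReal.ofReal |f x - u x| + ENNReal.ofReal |g x - v x|) ∂μ := by
          refine lintegral_mono fun x => ?_
          rw [← ENNReal.ofReal_add (abs_nonneg _) (abs_nonneg _)]
          exact ENNReal.ofReal_le_ofReal ((hφ _ _ _ _).trans
            (max_le_add_of_nonneg (abs_nonneg _) (abs_nonneg _)))
      _ = ∫⁻ x in K, ENNReal.ofReal |f x - u x| ∂μ + ∫⁻ x in K, ENNReal.ofReal |g x - v x| ∂μ := by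
          refine lintegral_add_left' ?_ _
          have := (hf.continuousOn.mono hKΩ).aemeasurable (μ := μ) hK.measurableSet
          exact ((this.sub hu.aemeasurable).norm).ennreal_ofReal
      _ ≤ η / 2 + η / 2 := add_le_add hfK.le hgK.le
      _ = η := ENNReal.add_halves η
  · calc ∫⁻ x in Ω, lipConst (fun x => φ (f x) (g x)) x ∂μ
        ≤ ∫⁻ x in Ω, (lipConst f x + lipConst g x) ∂μ :=
          lintegral_mono fun x => lipConst_map₂_le hφ f g x
      _ = ∫⁻ x in Ω, lipConst f x ∂μ + ∫⁻ x in Ω, lipConst g x ∂μ :=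
          lintegral_add_left' (aemeasurable_lipConst hΩ hf.continuousOn) _
      _ ≤ (tvOpen μ u Ω + ε / 2) + (tvOpen μ v Ω + ε / 2) := add_le_add hfΩ.le hgΩ.le
      _ = tvOpen μ u Ω + tvOpen μ v Ω + ε := by
          rw [add_add_add_comm, ENNReal.add_halves]

end TotalVariation

section Perimeter

variable {X : Type*} [MetricSpace X] [MeasurableSpace X] {μ : Measure X}

lemma perim_mono (E : Set X) {B B' : Set X} (h : B ⊆ B') : perim μ E B ≤ perim μ E B' :=
  tv_mono _ h

lemma perim_empty (B : Set X) : perim μ ∅ B = 0 := by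
  refine le_antisymm ((perim_mono ∅ (subset_univ B)).trans ?_) zero_le
  rw [perim, tv_eq_tvOpen _ isOpen_univ]
  refine sInf_le ⟨fun _ _ => 0, fun _ x _ => ⟨0, univ, univ_mem, LipschitzOnWith.of_dist_le_mul
    (by simp)⟩, fun K _ _ => by simp, ?_⟩
  have : lipConst (fun _ : X => (0 : ℝ)) = fun _ => 0 := by
    funext x
    simp only [lipConst, sub_self, abs_zero, zero_div, ENNReal.ofReal_zero]
    exact le_antisymm (limsup_le_of_le (h := by simp)) zero_le
  simp [this]

variable [BorelSpace X] [ProperSpace X]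

lemma perim_inter_le {E F : Set X} (hE : MeasurableSet E) {Ω : Set X} (hΩ : IsOpen Ω) :
    perim μ (E ∩ F) Ω ≤ perim μ E Ω + perim μ F Ω := by
  have h := tvOpen_map₂_le (μ := μ) abs_min_sub_min_le_max (u := E.indicator fun _ => (1 : ℝ))
    (v := F.indicator fun _ => (1 : ℝ)) (measurable_const.indicator hE) hΩ
  simp only [perim, tv_eq_tvOpen _ hΩ]
  convert h using 2
  funext x
  by_cases h1 : x ∈ E <;> by_cases h2 : x ∈ F <;> simp [h1, h2]

lemma perim_union_le {E F : Set X} (hE : MeasurableSet E) {Ω : Set X} (hΩ : IsOpen Ω) :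
    perim μ (E ∪ F) Ω ≤ perim μ E Ω + perim μ F Ω := by
  have h := tvOpen_map₂_le (μ := μ) abs_max_sub_max_le_max (u := E.indicator fun _ => (1 : ℝ))
    (v := F.indicator fun _ => (1 : ℝ)) (measurable_const.indicator hE) hΩ
  simp only [perim, tv_eq_tvOpen _ hΩ]
  convert h using 2
  funext x
  by_cases h1 : x ∈ E <;> by_cases h2 : x ∈ F <;> simp [h1, h2]

lemma FinPerim.inter {E F : Set X} (hE : FinPerim μ E) (hF : FinPerim μ F) :
    FinPerim μ (E ∩ F) :=
  ⟨hE.1.inter hF.1, (perim_inter_le hE.1 isOpen_univ).trans_lt (ENNReal.add_lt_top.2 ⟨hE.2, hF.2⟩)⟩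

lemma perim_biUnion_lt_le {E : ℕ → Set X} (hE : ∀ n, MeasurableSet (E n)) {Ω : Set X}
    (hΩ : IsOpen Ω) (N : ℕ) :
    perim μ (⋃ n < N, E n) Ω ≤ ∑ n ∈ Finset.range N, perim μ (E n) Ω := by
  induction N with
  | zero => simp [perim_empty]
  | succ N ih =>
    rw [biUnion_lt_succ, Finset.sum_range_succ]
    refine (perim_union_le ?_ hΩ).trans (add_le_add_left ih _)
    exact .iUnion fun n => .iUnion fun _ => hE n

lemma perim_iUnion_le [IsLocallyFiniteMeasure μ] {E : ℕ → Set X} (hE : ∀ n, MeasurableSet (E n))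
    {Ω : Set X} (hΩ : IsOpen Ω) : perim μ (⋃ n, E n) Ω ≤ ∑' n, perim μ (E n) Ω := by
  have hA : ∀ N : ℕ, MeasurableSet (⋃ n < N, E n) := fun N =>
    .iUnion fun n => .iUnion fun _ => hE n
  rw [perim, tv_eq_tvOpen _ hΩ]
  refine tvOpen_le_of_tendstoL1loc (u := fun N => (⋃ n < N, E n).indicator fun _ => 1)
    (fun N => measurable_const.indicator (hA N))
    (measurable_const.indicator (MeasurableSet.iUnion hE)) hΩ (fun K hK hKΩ => ?_) fun N => ?_
  · have hlim : ∀ x, Tendsto (fun N : ℕ => ENNReal.ofReal |(⋃ n < N, E n).indicator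
        (fun _ => (1 : ℝ)) x - (⋃ n, E n).indicator (fun _ => (1 : ℝ)) x|) atTop (𝓝 0) := by
      intro x
      refine tendsto_const_nhds.congr' ?_
      by_cases hx : x ∈ ⋃ n, E n
      · obtain ⟨m, hm⟩ := mem_iUnion.1 hx
        filter_upwards [eventually_gt_atTop m] with N hN
        have : x ∈ ⋃ n < N, E n := mem_biUnion (show m < N from hN) hm
        rw [indicator_of_mem this, indicator_of_mem hx]
        simp
      · filter_upwards with N
        have : x ∉ ⋃ n < N, E n := fun h => hx (iUnion₂_subset (fun n _ => subset_iUnion E n) h)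
        rw [indicator_of_notMem this, indicator_of_notMem hx]
        simp
    have hmeas : ∀ N : ℕ, Measurable fun x => ENNReal.ofReal |(⋃ n < N, E n).indicator
        (fun _ => (1 : ℝ)) x - (⋃ n, E n).indicator (fun _ => (1 : ℝ)) x| := fun N =>
      (((measurable_const (a := (1 : ℝ))).indicator (hA N)).sub
        ((measurable_const (a := (1 : ℝ))).indicator (.iUnion hE))).norm.ennreal_ofReal
    have hdom := tendsto_lintegral_of_dominated_convergence (μ := μ.restrict K)
      (F := fun N x => ENNReal.ofReal |(⋃ n < N, E n).indicator
        (fun _ => (1 : ℝ)) x - (⋃ n, E n).indicator (fun _ => (1 : ℝ)) x|) (f := fun _ => 0)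
      (fun _ => 1) (fun N => hmeas N)
      (fun N => Eventually.of_forall fun x => ?_) (by simpa using hK.measure_lt_top.ne)
      (Eventually.of_forall hlim)
    · simpa using hdom
    · by_cases h1 : x ∈ ⋃ n < N, E n <;> by_cases h2 : x ∈ ⋃ n, E n <;>
        simp only [indicator_of_mem, indicator_of_notMem, h1, h2, not_false_eq_true] <;> simp
  · have := perim_biUnion_lt_le (μ := μ) hE hΩ N
    rw [perim, tv_eq_tvOpen _ hΩ] at this
    exact this.trans (ENNReal.sum_le_tsum _)

end Perimeter

section Density

variable {X : Type*} [MetricSpace X] [MeasurableSpace X] {μ : Measure X}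

lemma upperDens_mono {E F : Set X} (h : E ⊆ F) (x : X) : upperDens μ E x ≤ upperDens μ F x :=
  limsup_le_limsup (Eventually.of_forall fun r =>
    ENNReal.div_le_div_right (measure_mono (inter_subset_inter_left _ h)) _)

lemma upperDens_union_eq_zero {E F : Set X} {x : X} (hE : upperDens μ E x = 0)
    (hF : upperDens μ F x = 0) : upperDens μ (E ∪ F) x = 0 := by
  refine le_antisymm (le_of_forall_gt fun ε hε => ?_) zero_le
  obtain ⟨η, hη, hηε⟩ := exists_between hε
  have hη2 : 0 < η / 2 := ENNReal.half_pos hη.ne'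
  refine (limsup_le_of_le (h := ?_)).trans_lt hηε
  filter_upwards [eventually_lt_of_limsup_lt (hE.trans_lt hη2),
    eventually_lt_of_limsup_lt (hF.trans_lt hη2)] with r h1 h2
  calc μ ((E ∪ F) ∩ ball x r) / μ (ball x r)
      ≤ (μ (E ∩ ball x r) + μ (F ∩ ball x r)) / μ (ball x r) := by
        rw [union_inter_distrib_right]
        exact ENNReal.div_le_div_right (measure_union_le _ _) _
    _ ≤ η / 2 + η / 2 := by
        rw [ENNReal.add_div]
        exact add_le_add h1.le h2.le
    _ = η := ENNReal.add_halves η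

lemma upperDens_eq_iInf (E : Set X) (x : X) :
    upperDens μ E x = ⨅ n : ℕ, ⨆ q : ℚ, ⨆ _ : (q : ℝ) ∈ Ioo (0 : ℝ) (1 / (n + 1)),
      μ (E ∩ ball x q) / μ (ball x q) := by
  have hbasis : (𝓝[>] (0 : ℝ)).HasBasis (fun _ : ℕ => True)
      fun n => Ioo (0 : ℝ) (1 / ((n : ℝ) + 1)) := by
    refine (nhdsGT_basis (0 : ℝ)).to_hasBasis (fun ε hε => ?_) fun n _ =>
      ⟨1 / ((n : ℝ) + 1), by positivity, Subset.rfl⟩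
    obtain ⟨n, hn⟩ := exists_nat_one_div_lt hε
    exact ⟨n, trivial, Ioo_subset_Ioo_right hn.le⟩
  rw [upperDens, hbasis.limsup_eq_iInf_iSup]
  simp only [iInf_true]
  refine iInf_congr fun n => le_antisymm (iSup₂_le fun r hr => ?_)
    (iSup₂_le fun q hq => le_iSup₂ (f := fun (r : ℝ) (_ : r ∈ Ioo (0 : ℝ) (1 / ((n : ℝ) + 1))) =>
      μ (E ∩ ball x r) / μ (ball x r)) (q : ℝ) hq)
  obtain ⟨q, hqmono, hqlt, hqlim⟩ := Real.exists_seq_rat_strictMono_tendsto r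
  have hunion : E ∩ ball x r = ⋃ k, E ∩ ball x (q k) := by
    rw [← inter_iUnion]
    congr 1
    refine Subset.antisymm (fun y hy => ?_) (iUnion_subset fun k => ball_subset_ball (hqlt k).le)
    obtain ⟨k, hk⟩ := (hqlim.eventually_const_lt (mem_ball.1 hy)).exists
    exact mem_iUnion.2 ⟨k, hk⟩
  have hmono : Monotone fun k => E ∩ ball x (q k) := fun k l hkl =>
    inter_subset_inter_right _ (ball_subset_ball (by exact_mod_cast hqmono.monotone hkl))
  rw [hunion, hmono.measure_iUnion, ENNReal.iSup_div]
  refine iSup_le fun k => ?_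
  rcases le_or_gt (q k : ℝ) 0 with h0 | h0
  · simp [ball_eq_empty.2 h0]
  · calc μ (E ∩ ball x (q k)) / μ (ball x r) ≤ μ (E ∩ ball x (q k)) / μ (ball x (q k)) :=
          ENNReal.div_le_div_left (measure_mono (ball_subset_ball (hqlt k).le)) _
      _ ≤ _ := le_iSup₂ (f := fun (q : ℚ) (_ : (q : ℝ) ∈ Ioo (0 : ℝ) (1 / ((n : ℝ) + 1))) =>
          μ (E ∩ ball x q) / μ (ball x q)) (q k) ⟨h0, (hqlt k).trans hr.2⟩

lemma measurable_upperDens [BorelSpace X] [SecondCountableTopology X] [SFinite μ] {E : Set X}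
    (hE : MeasurableSet E) : Measurable (upperDens μ E) := by
  have hball : ∀ (A : Set X) (r : ℝ), MeasurableSet A → Measurable fun x => μ (A ∩ ball x r) := by
    intro A r hA
    have hs : MeasurableSet {p : X × X | p.2 ∈ A ∧ dist p.2 p.1 < r} :=
      (measurable_snd hA).inter (measurableSet_lt (measurable_snd.dist measurable_fst)
        measurable_const)
    exact measurable_measure_prodMk_left hs
  have : upperDens μ E = fun x => ⨅ n : ℕ, ⨆ q : ℚ, ⨆ _ : (q : ℝ) ∈ Ioo (0 : ℝ) (1 / (n + 1)),
      μ (E ∩ ball x q) / μ (ball x q) := funext fun x => upperDens_eq_iInf E x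
  rw [this]
  refine .iInf fun n => .iSup fun q => .iSup fun _ => (hball E q hE).div ?_
  simpa using hball univ q .univ

lemma measurableSet_essBdry [BorelSpace X] [SecondCountableTopology X] [SFinite μ] {E : Set X}
    (hE : MeasurableSet E) : MeasurableSet (essBdry μ E) :=
  (measurableSet_lt measurable_const (measurable_upperDens hE)).inter
    (measurableSet_lt measurable_const (measurable_upperDens hE.compl))

lemma mem_essBdry_of_disjoint {E F : Set X} (h : Disjoint E F) {x : X}
    (hE : 0 < upperDens μ E x) (hF : 0 < upperDens μ F x) : x ∈ essBdry μ E :=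
  ⟨hE, hF.trans_le (upperDens_mono h.subset_compl_left x)⟩

/-- A boundary point of `F ∩ A` with `F ⊆ E` lies on the boundary of `F`, unless it
lies on the boundary of `A` but not on that of `E`. -/
lemma essBdry_inter_diff_subset {E F A : Set X} (hF : F ⊆ E) :
    essBdry μ (F ∩ A) \ essBdry μ F ⊆ essBdry μ A \ essBdry μ E := by
  rintro x ⟨⟨h1, h2⟩, h3⟩
  have hFpos : 0 < upperDens μ F x := h1.trans_le (upperDens_mono inter_subset_left x)
  have hApos : 0 < upperDens μ A x := h1.trans_le (upperDens_mono inter_subset_right x)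
  have hF0 : upperDens μ Fᶜ x = 0 := by
    by_contra h
    exact h3 ⟨hFpos, pos_iff_ne_zero.2 h⟩
  refine ⟨⟨hApos, pos_iff_ne_zero.2 fun h => h2.ne' ?_⟩, fun h => h.2.ne' ?_⟩
  · rw [compl_inter]
    exact upperDens_union_eq_zero hF0 h
  · exact le_antisymm ((upperDens_mono (compl_subset_compl.2 hF) x).trans hF0.le) zero_le

end Density

section Doubling

variable {X : Type*} [MetricSpace X] [MeasurableSpace X] {μ : Measure X} {CD : ℝ≥0}

lemma Doubling.measure_ball_pow_le (h : Doubling μ CD) (x : X) {r : ℝ} (hr : 0 < r) (k : ℕ) :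
    μ (ball x (2 ^ k * r)) ≤ (CD : ℝ≥0∞) ^ k * μ (ball x r) := by
  induction k with
  | zero => simp
  | succ k ih =>
    rw [pow_succ', mul_assoc, pow_succ', mul_assoc]
    exact (h.2 x _ (by positivity)).trans (by gcongr)

lemma exists_le_two_pow_mul (R : ℝ) {r : ℝ} (hr : 0 < r) : ∃ k : ℕ, R ≤ 2 ^ k * r := by
  obtain ⟨k, hk⟩ := pow_unbounded_of_one_lt (R / r) one_lt_two
  exact ⟨k, ((div_lt_iff₀ hr).1 hk).le⟩

lemma Doubling.measure_ball_pos (h : Doubling μ CD) (hμ : μ ≠ 0) (x : X) {r : ℝ} (hr : 0 < r) :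
    0 < μ (ball x r) := by
  refine pos_iff_ne_zero.2 fun h0 => hμ (Measure.measure_univ_eq_zero.1 ?_)
  rw [← iUnion_ball_nat x, measure_iUnion_null_iff]
  intro n
  obtain ⟨k, hk⟩ := exists_le_two_pow_mul n hr
  refine measure_mono_null (ball_subset_ball hk) (le_antisymm ?_ zero_le)
  simpa [h0] using h.measure_ball_pow_le x hr k

lemma Doubling.measure_ball_lt_top [IsLocallyFiniteMeasure μ] (h : Doubling μ CD) (x : X)
    (R : ℝ) : μ (ball x R) < ⊤ := by
  obtain ⟨s, hs, hfin⟩ := μ.finiteAt_nhds x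
  obtain ⟨r, hr, hrs⟩ := Metric.mem_nhds_iff.1 hs
  obtain ⟨k, hk⟩ := exists_le_two_pow_mul R hr
  calc μ (ball x R) ≤ μ (ball x (2 ^ k * r)) := measure_mono (ball_subset_ball hk)
    _ ≤ (CD : ℝ≥0∞) ^ k * μ (ball x r) := h.measure_ball_pow_le x hr k
    _ < ⊤ := ENNReal.mul_lt_top (by finiteness) ((measure_mono hrs).trans_lt hfin)

lemma Doubling.totallyBounded_ball [IsLocallyFiniteMeasure μ] [OpensMeasurableSpace X]
    (h : Doubling μ CD) (hμ : μ ≠ 0) (x : X) (R : ℝ) : TotallyBounded (ball x R) := by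
  rw [Metric.totallyBounded_iff]
  by_contra! hcon
  obtain ⟨ε, hε, hcov⟩ := hcon
  have hstep : ∀ t : Set X, t.Finite → ∃ c, c ∈ ball x R ∧ ∀ y ∈ t, ε ≤ dist c y := by
    intro t ht
    obtain ⟨c, hc, hct⟩ := not_subset.1 (hcov t ht)
    exact ⟨c, hc, fun y hy => not_lt.1 fun hlt => hct (mem_biUnion hy hlt)⟩
  obtain ⟨u, hu⟩ := seq_of_forall_finite_exists hstep
  have hsep : Pairwise (Function.onFun Disjoint fun n => ball (u n) (ε / 2)) := by
    have hlt : ∀ m n, m < n → Disjoint (ball (u m) (ε / 2)) (ball (u n) (ε / 2)) := by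
      intro m n hmn
      refine ball_disjoint_ball ?_
      have := (hu n).2 (u m) (mem_image_of_mem u hmn)
      rw [dist_comm]
      linarith
    exact fun m n hmn => hmn.lt_or_gt.elim (hlt m n) fun h => (hlt n m h).symm
  obtain ⟨k, hk⟩ := exists_le_two_pow_mul (2 * R) (half_pos hε)
  have hR : 0 < R := dist_nonneg.trans_lt (mem_ball.1 (hu 0).1)
  have hlower : ∀ n, μ (ball x R) / (CD : ℝ≥0∞) ^ k ≤ μ (ball (u n) (ε / 2)) := by
    intro n
    refine ENNReal.div_le_of_le_mul' ((measure_mono fun y hy => ?_).trans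
      (h.measure_ball_pow_le (u n) (half_pos hε) k))
    have h1 := dist_triangle_right y (u n) x
    have h2 := mem_ball.1 (hu n).1
    rw [mem_ball] at hy ⊢
    linarith
  have hfin : μ (⋃ n, ball (u n) (ε / 2)) ≠ ⊤ := by
    refine ((measure_mono (iUnion_subset fun n y hy => ?_)).trans_lt
      (h.measure_ball_lt_top x (R + ε))).ne
    have h1 := dist_triangle y (u n) x
    have h2 := mem_ball.1 (hu n).1
    rw [mem_ball] at hy ⊢
    linarith
  have := Measure.finite_const_le_meas_of_disjoint_iUnion μ
    (ε := μ (ball x R) / (CD : ℝ≥0∞) ^ k)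
    (ENNReal.div_pos (h.measure_ball_pos hμ x hR).ne' (ENNReal.pow_ne_top ENNReal.coe_ne_top))
    (fun n => measurableSet_ball) hsep hfin
  exact infinite_univ (this.subset fun n _ => hlower n)

lemma Doubling.properSpace [IsLocallyFiniteMeasure μ] [OpensMeasurableSpace X] [CompleteSpace X]
    (h : Doubling μ CD) (hμ : μ ≠ 0) : ProperSpace X :=
  ⟨fun x R => isCompact_iff_totallyBounded_isComplete.2
    ⟨((h.totallyBounded_ball hμ x (R + 1)).subset (closedBall_subset_ball (lt_add_one R))),
    isClosed_closedBall.isComplete⟩⟩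

end Doubling

section Representation

variable {X : Type*} [MetricSpace X] [MeasurableSpace X] {μ : Measure X}
  {θ : Set X → X → ℝ≥0∞}

lemma PerimRepr.codimH_empty (hθ : PerimRepr μ θ) : codimH μ (∅ : Set X) = 0 := by
  obtain ⟨γ, C, -, -, h⟩ := hθ
  have h1 := (h ∅ ⟨.empty, by simp [perim_empty]⟩).2 ∅ .empty
  simpa [perim_empty, outerLint, eq_comm] using h1

lemma PerimRepr.perim_eq_zero_of_codimH (hθ : PerimRepr μ θ) {A B : Set X} (hA : FinPerim μ A)
    (hB : MeasurableSet B) (h0 : codimH μ (B ∩ essBdry μ A) = 0) : perim μ A B = 0 := by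
  obtain ⟨γ, C, -, -, h⟩ := hθ
  rw [(h A hA).2 B hB, outerLint]
  have : ∀ t : ℝ, codimH μ {x ∈ B ∩ essBdry μ A | ENNReal.ofReal t < θ A x} = 0 := fun t =>
    le_antisymm ((codimH_mono (sep_subset _ _)).trans h0.le) zero_le
  rw [lintegral_congr this, lintegral_zero]

lemma PerimRepr.codimH_eq_zero_of_perim (hθ : PerimRepr μ θ) {A B : Set X} (hA : FinPerim μ A)
    (hB : MeasurableSet B) (hBA : B ⊆ essBdry μ A) (h0 : perim μ A B = 0) : codimH μ B = 0 := by
  obtain ⟨γ, C, hγ, -, h⟩ := hθ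
  rw [(h A hA).2 B hB, outerLint, inter_eq_self_of_subset_left hBA] at h0
  obtain ⟨c, hc0, hcγ⟩ := ENNReal.lt_iff_exists_nnreal_btwn.1 hγ
  have hle : ∫⁻ _ in Ioo (0 : ℝ) c, codimH μ B ≤ 0 := by
    refine (setLIntegral_mono' measurableSet_Ioo fun t ht => codimH_mono fun x hx => ?_).trans
      ((lintegral_mono_set Ioo_subset_Ioi_self).trans h0.le)
    refine ⟨hx, lt_of_le_of_lt ?_ (hcγ.trans_le ((h A hA).1 x (hBA hx)).1)⟩
    exact ENNReal.ofReal_le_of_le_toReal (by simpa using ht.2.le)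
  have hc : (c : ℝ≥0∞) ≠ 0 := hc0.ne'
  simpa [ENNReal.coe_ne_zero.1 hc] using hle

lemma PerimRepr.perim_eq_of_codimH_ne (hθ : PerimRepr μ θ) {E F B : Set X} (hE : FinPerim μ E)
    (hF : FinPerim μ F) (hne : codimH μ {x ∈ essBdry μ F ∩ essBdry μ E | θ F x ≠ θ E x} = 0)
    (hB : MeasurableSet B) (hBF : B ⊆ essBdry μ F) (hBE : B ⊆ essBdry μ E) :
    perim μ F B = perim μ E B := by
  have hle : ∀ s t : Set X, s ⊆ t ∪ {x ∈ essBdry μ F ∩ essBdry μ E | θ F x ≠ θ E x} →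
      codimH μ s ≤ codimH μ t := fun s t hst => by
    have h1 : codimH μ s ≤ codimH μ t + _ :=
      (codimH_mono hst).trans (measure_union_le (μ := codimOuter hθ.codimH_empty) _ _)
    rwa [codimOuter_apply, hne, add_zero] at h1
  obtain ⟨γ, C, -, -, h⟩ := hθ
  rw [(h F hF).2 B hB, (h E hE).2 B hB, inter_eq_self_of_subset_left hBF,
    inter_eq_self_of_subset_left hBE]
  refine lintegral_congr fun t => le_antisymm (hle _ _ ?_) (hle _ _ ?_)
  · rintro x ⟨hx, ht⟩
    by_cases hxθ : θ F x = θ E x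
    · exact .inl ⟨hx, hxθ ▸ ht⟩
    · exact .inr ⟨⟨hBF hx, hBE hx⟩, hxθ⟩
  · rintro x ⟨hx, ht⟩
    by_cases hxθ : θ F x = θ E x
    · exact .inl ⟨hx, hxθ ▸ ht⟩
    · exact .inr ⟨⟨hBF hx, hBE hx⟩, hxθ⟩

lemma PerimRepr.exists_measure [BorelSpace X] (hθ : PerimRepr μ θ) {A : Set X}
    (hA : FinPerim μ A) : ∃ ν : Measure X, ∀ B, MeasurableSet B → ν B = perim μ A B := by
  obtain ⟨ν, hν⟩ := exists_measure_outerLint hθ.codimH_empty (essBdry μ A) (θ A)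
  obtain ⟨γ, C, -, -, h⟩ := hθ
  exact ⟨ν, fun B hB => by rw [hν B hB, (h A hA).2 B hB]⟩

end Representation

section Additivity

variable {X : Type*} [MetricSpace X] [MeasurableSpace X] [BorelSpace X] [ProperSpace X]
  {μ : Measure X} [IsLocallyFiniteMeasure μ] {θ : Set X → X → ℝ≥0∞}

/-- If the perimeter is countably additive in `Ω`, then so it is in every Borel subset of `Ω`. -/
lemma PerimRepr.perim_eq_tsum_of_subset (hθ : PerimRepr μ θ) {E Ω : Set X} (hE : FinPerim μ E)
    (hΩ : IsOpen Ω) {En : ℕ → Set X} (hEn : ∀ n, FinPerim μ (En n)) (hunion : (⋃ n, En n) = E)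
    (hadd : perim μ E Ω = ∑' n, perim μ (En n) Ω) {B : Set X} (hB : MeasurableSet B)
    (hBΩ : B ⊆ Ω) : perim μ E B = ∑' n, perim μ (En n) B := by
  obtain ⟨ν, hν⟩ := hθ.exists_measure hE
  choose κ hκ using fun n => hθ.exists_measure (hEn n)
  let σ : Measure X := Measure.sum κ
  have hσ : ∀ B, MeasurableSet B → σ B = ∑' n, perim μ (En n) B := fun B hB => by
    rw [Measure.sum_apply _ hB]
    exact tsum_congr fun n => hκ n B hB
  have hΩfin : perim μ E Ω < ⊤ := (perim_mono E (subset_univ Ω)).trans_lt hE.2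
  have : IsFiniteMeasure (σ.restrict Ω) := ⟨by
    rw [Measure.restrict_apply_univ, hσ Ω hΩ.measurableSet, ← hadd]
    exact hΩfin⟩
  have hle : ∀ B, MeasurableSet B → B ⊆ Ω → ν B ≤ σ B := by
    intro B hB hBΩ
    have hres : σ.restrict Ω B = σ B := by
      rw [Measure.restrict_apply hB, inter_eq_self_of_subset_left hBΩ]
    rw [← hres, B.measure_eq_iInf_isOpen (σ.restrict Ω)]
    refine le_iInf₂ fun U hBU => le_iInf fun hU => ?_
    have hUΩ := hU.inter hΩ
    rw [Measure.restrict_apply hU.measurableSet, hσ _ hUΩ.measurableSet]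
    calc ν B ≤ ν (U ∩ Ω) := measure_mono (subset_inter hBU hBΩ)
      _ = perim μ (⋃ n, En n) (U ∩ Ω) := by rw [hν _ hUΩ.measurableSet, hunion]
      _ ≤ _ := perim_iUnion_le (fun n => (hEn n).1) hUΩ
  have htotal : ν B + ν (Ω \ B) = σ B + σ (Ω \ B) := by
    rw [measure_add_sdiff hB.nullMeasurableSet, measure_add_sdiff hB.nullMeasurableSet,
      union_eq_self_of_subset_left hBΩ, hν Ω hΩ.measurableSet, hσ Ω hΩ.measurableSet, hadd]
  have hdiff : ν (Ω \ B) ≠ ⊤ :=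
    ((measure_mono sdiff_subset).trans_lt ((hν Ω hΩ.measurableSet).trans_lt hΩfin)).ne
  rw [← hν B hB, ← hσ B hB]
  refine le_antisymm (hle B hB hBΩ) ((ENNReal.add_le_add_iff_right hdiff).1 ?_)
  rw [htotal]
  exact add_le_add_right (hle _ (hΩ.measurableSet.diff hB) sdiff_subset) _

end Additivity

section Partition

variable {X : Type*} [MetricSpace X] [MeasurableSpace X] [BorelSpace X] [ProperSpace X]
  {μ : Measure X} [IsLocallyFiniteMeasure μ] {θ : Set X → X → ℝ≥0∞}

/-- If the perimeter is countably additive in `Ω`, then up to `H`-null sets the pieces have no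
essential boundary in `Ω` outside that of the whole set. -/
lemma PerimRepr.codimH_essBdry_diff_eq_zero (hθ : PerimRepr μ θ) {E Ω : Set X}
    (hE : FinPerim μ E) (hΩ : IsOpen Ω) {En : ℕ → Set X} (hEn : ∀ n, FinPerim μ (En n))
    (hunion : (⋃ n, En n) = E) (hadd : perim μ E Ω = ∑' n, perim μ (En n) Ω) (n : ℕ) :
    codimH μ (Ω ∩ (essBdry μ (En n) \ essBdry μ E)) = 0 := by
  have hB : MeasurableSet (Ω ∩ (essBdry μ (En n) \ essBdry μ E)) :=
    hΩ.measurableSet.inter ((measurableSet_essBdry (hEn n).1).diff (measurableSet_essBdry hE.1))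
  have h0 : perim μ E (Ω ∩ (essBdry μ (En n) \ essBdry μ E)) = 0 := by
    refine hθ.perim_eq_zero_of_codimH hE hB ?_
    rw [inter_assoc, sdiff_inter_self, inter_empty, hθ.codimH_empty]
  rw [hθ.perim_eq_tsum_of_subset hE hΩ hEn hunion hadd hB inter_subset_left,
    ENNReal.tsum_eq_zero] at h0
  exact hθ.codimH_eq_zero_of_perim (hEn n) hB (inter_subset_right.trans sdiff_subset) (h0 n)

/-- If the perimeter is countably additive in `Ω`, then the essential boundaries of the pieces
are `H`-essentially disjoint in `Ω`. -/
lemma PerimRepr.codimH_essBdry_inter_eq_zero (hθ : PerimRepr μ θ)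
    (hiso : ∀ E F : Set X, FinPerim μ E → FinPerim μ F → F ⊆ E →
      codimH μ {x ∈ essBdry μ F ∩ essBdry μ E | θ F x ≠ θ E x} = 0)
    {E Ω : Set X} (hE : FinPerim μ E) (hΩ : IsOpen Ω) {En : ℕ → Set X}
    (hEn : ∀ n, FinPerim μ (En n)) (hunion : (⋃ n, En n) = E)
    (hadd : perim μ E Ω = ∑' n, perim μ (En n) Ω) {m n : ℕ} (hmn : m ≠ n) :
    codimH μ (Ω ∩ (essBdry μ (En m) ∩ essBdry μ (En n))) = 0 := by
  let B := Ω ∩ (essBdry μ (En m) ∩ essBdry μ (En n)) ∩ essBdry μ E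
  have hB : MeasurableSet B :=
    (hΩ.measurableSet.inter ((measurableSet_essBdry (hEn m).1).inter
      (measurableSet_essBdry (hEn n).1))).inter (measurableSet_essBdry hE.1)
  have hsub : ∀ k, En k ⊆ E := fun k => hunion ▸ subset_iUnion En k
  have hm : perim μ (En m) B = perim μ E B :=
    hθ.perim_eq_of_codimH_ne hE (hEn m) (hiso E _ hE (hEn m) (hsub m)) hB
      (fun x hx => hx.1.2.1) fun x hx => hx.2
  have hn : perim μ (En n) B = perim μ E B :=
    hθ.perim_eq_of_codimH_ne hE (hEn n) (hiso E _ hE (hEn n) (hsub n)) hB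
      (fun x hx => hx.1.2.2) fun x hx => hx.2
  have hfin : perim μ E B ≠ ⊤ := ((perim_mono E (subset_univ B)).trans_lt hE.2).ne
  have hle : perim μ E B + perim μ E B ≤ perim μ E B + 0 := by
    conv_rhs => rw [hθ.perim_eq_tsum_of_subset hE hΩ hEn hunion hadd hB fun x hx => hx.1.1]
    rw [add_zero]
    have := ENNReal.sum_le_tsum (f := fun k => perim μ (En k) B) {m, n}
    rwa [Finset.sum_pair hmn, hm, hn] at this
  have hB0 : codimH μ B = 0 := hθ.codimH_eq_zero_of_perim hE hB inter_subset_right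
    (nonpos_iff_eq_zero.1 ((ENNReal.add_le_add_iff_left hfin).1 hle))
  have hcover : Ω ∩ (essBdry μ (En m) ∩ essBdry μ (En n)) ⊆
      B ∪ Ω ∩ (essBdry μ (En m) \ essBdry μ E) := fun x hx => by
    by_cases hxE : x ∈ essBdry μ E
    · exact .inl ⟨hx, hxE⟩
    · exact .inr ⟨hx.1, hx.2.1, hxE⟩
  have hunionle := measure_union_le (μ := codimOuter hθ.codimH_empty) B
    (Ω ∩ (essBdry μ (En m) \ essBdry μ E))
  rw [codimOuter_apply, codimOuter_apply, codimOuter_apply, hB0,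
    hθ.codimH_essBdry_diff_eq_zero hE hΩ hEn hunion hadd m, add_zero] at hunionle
  exact nonpos_iff_eq_zero.1 ((codimH_mono hcover).trans hunionle)

end Partition

variable {X : Type*} [MetricSpace X] [CompleteSpace X] [TopologicalSpace.SeparableSpace X]
  [MeasurableSpace X] [BorelSpace X]

/-- Countable perimeter additivity passes to subsets. -/
theorem perim_countably_additive_restrict
    (μ : Measure X) [IsLocallyFiniteMeasure μ] (hμ : μ ≠ 0)
    (hPI : IsPI μ) (hIso : Isotropic μ)
    (E Ω : Set X) (hE : FinPerim μ E) (hΩ : IsOpen Ω)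
    (En : ℕ → Set X) (hEn : ∀ n, FinPerim μ (En n))
    (hdisj : Pairwise (Function.onFun Disjoint En)) (hunion : (⋃ n, En n) = E)
    (hadd : perim μ E Ω = ∑' n, perim μ (En n) Ω) :
    ∀ F : Set X, F ⊆ E → FinPerim μ F →
      perim μ F Ω = ∑' n, perim μ (F ∩ En n) Ω := by
  intro F hFE hF
  obtain ⟨CD, -, -, hdoub, -⟩ := hPI
  obtain ⟨θ, hθ, hiso⟩ := hIso
  have := hdoub.properSpace hμ
  have hFn : ∀ n, FinPerim μ (F ∩ En n) := fun n => hF.inter (hEn n)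
  refine le_antisymm ?_ ?_
  · have h := perim_iUnion_le (μ := μ) (fun n => (hFn n).1) hΩ
    rwa [← inter_iUnion, hunion, inter_eq_self_of_subset_left hFE] at h
  obtain ⟨ν, hν⟩ := hθ.exists_measure hF
  let A : ℕ → Set X := fun n => Ω ∩ (essBdry μ (F ∩ En n) ∩ essBdry μ F)
  have hA : ∀ n, MeasurableSet (A n) := fun n =>
    hΩ.measurableSet.inter ((measurableSet_essBdry (hFn n).1).inter (measurableSet_essBdry hF.1))
  have hAν : ∀ n, perim μ (F ∩ En n) Ω = ν (A n) := by
    intro n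
    obtain ⟨κ, hκ⟩ := hθ.exists_measure (hFn n)
    have hdiff : κ (Ω \ A n) = 0 := by
      rw [hκ _ (hΩ.measurableSet.diff (hA n))]
      refine hθ.perim_eq_zero_of_codimH (hFn n) (hΩ.measurableSet.diff (hA n)) ?_
      refine nonpos_iff_eq_zero.1 ((codimH_mono fun x hx => ?_).trans
        (hθ.codimH_essBdry_diff_eq_zero hE hΩ hEn hunion hadd n).le)
      exact ⟨hx.1.1, essBdry_inter_diff_subset hFE
        ⟨hx.2, fun hxF => hx.1.2 ⟨hx.1.1, hx.2, hxF⟩⟩⟩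
    rw [hν _ (hA n), ← hθ.perim_eq_of_codimH_ne hF (hFn n)
      (hiso F _ hF (hFn n) inter_subset_left) (hA n) (fun x hx => hx.2.1) (fun x hx => hx.2.2),
      ← hκ _ hΩ.measurableSet, ← hκ _ (hA n)]
    exact (measure_eq_measure_of_null_sdiff inter_subset_left hdiff).symm
  have hAdisj : Pairwise (Function.onFun (AEDisjoint ν) A) := by
    intro m n hmn
    have hd := hdisj hmn
    rw [Function.onFun, AEDisjoint, hν _ ((hA m).inter (hA n))]
    refine hθ.perim_eq_zero_of_codimH hF ((hA m).inter (hA n)) (nonpos_iff_eq_zero.1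
      ((codimH_mono fun x hx => ?_).trans
        (hθ.codimH_essBdry_inter_eq_zero hiso hE hΩ hEn hunion hadd hmn).le))
    have hxm : 0 < upperDens μ (En m) x :=
      hx.1.1.2.1.1.trans_le (upperDens_mono inter_subset_right x)
    have hxn : 0 < upperDens μ (En n) x :=
      hx.1.2.2.1.1.trans_le (upperDens_mono inter_subset_right x)
    exact ⟨hx.1.1.1, mem_essBdry_of_disjoint hd hxm hxn, mem_essBdry_of_disjoint hd.symm hxn hxm⟩
  calc ∑' n, perim μ (F ∩ En n) Ω = ∑' n, ν (A n) := tsum_congr hAν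
    _ ≤ ν (⋃ n, A n) :=
      tsum_meas_le_meas_iUnion_of_disjoint₀ ν (fun n => (hA n).nullMeasurableSet) hAdisj
    _ ≤ ν Ω := measure_mono (iUnion_subset fun n => inter_subset_left)
    _ = perim μ F Ω := hν Ω hΩ.measurableSet

end PaperBV
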